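/- arXiv:2503.13193 — 2 statements merged into one kernel-verified Lean document; each statement's English description precedes it below -/
import Mathlib

section
/- Let d ∈ ℕ, T > 0, σ > 0, and let φ : ℝ^d → ℝ be bounded and continuous. Let γ^d be the standard Gaussian measure on ℝ^d (the d-fold product of the Gaussian measure on ℝ with mean 0 and variance 1). Define w : [0,T] × ℝ^d → ℝ by w(t,x) := ∫_{ℝ^d} φ(x + σ√(T−t)·y) dγ^d(y). Then: (i) w is continuous on [0,T] × ℝ^d; (ii) on [0,T) × ℝ^d, w is differentiable in t and twice continuously differentiable in x and satisfies the terminal-value heat equation ∂_t w(t,x) + (σ²/2) Δ_x w(t,x) = 0; and (iii) w(T,x) = φ(x) for all x ∈ ℝ^d. -/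
open MeasureTheory ProbabilityTheory

/-- The spatial Laplacian of `f : ℝ^d → ℝ` at `x` (trace of the Hessian). -/
noncomputable def lap' (d : ℕ) (f : (Fin d → ℝ) → ℝ) (x : Fin d → ℝ) : ℝ :=
  ∑ i : Fin d, fderiv ℝ (fun y => fderiv ℝ f y (Pi.single i 1)) x (Pi.single i 1)

/-- The standard Gaussian measure on `ℝ^d`. -/
noncomputable def stdGaussian (d : ℕ) : Measure (Fin d → ℝ) :=
  Measure.pi fun _ : Fin d => gaussianReal 0 1

/-- The squared Euclidean length of a vector of `ℝ^d` (whose norm is the sup norm). -/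
noncomputable def sqLen {d : ℕ} (u : Fin d → ℝ) : ℝ := ∑ i, u i ^ 2

/-- The derivative of `sqLen`, as a continuous bilinear form. -/
noncomputable def sqLenDeriv (d : ℕ) : (Fin d → ℝ) →L[ℝ] (Fin d → ℝ) →L[ℝ] ℝ :=
  ∑ i, (2 : ℝ) • (ContinuousLinearMap.proj (R := ℝ) (φ := fun _ : Fin d => ℝ) i).smulRight
    (ContinuousLinearMap.proj (R := ℝ) (φ := fun _ : Fin d => ℝ) i)

/-- An integrable weight on `ℝ^d` with polynomial decay. -/
noncomputable def japaneseWeight {d : ℕ} (u : Fin d → ℝ) : ℝ := (1 + ‖u‖) ^ (-((d : ℝ) + 1))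

lemma sqLenDeriv_apply {d : ℕ} (u v : Fin d → ℝ) :
    sqLenDeriv d u v = ∑ i, 2 * (u i * v i) := by
  simp [sqLenDeriv]

lemma continuous_sqLen {d : ℕ} : Continuous (sqLen : (Fin d → ℝ) → ℝ) := by
  unfold sqLen; fun_prop

lemma sqLen_neg {d : ℕ} (u : Fin d → ℝ) : sqLen (-u) = sqLen u := by simp [sqLen]

lemma sqLen_smul {d : ℕ} (r : ℝ) (u : Fin d → ℝ) : sqLen (r • u) = r ^ 2 * sqLen u := by
  simp [sqLen, mul_pow, Finset.mul_sum]

lemma sqLen_nonneg {d : ℕ} (u : Fin d → ℝ) : 0 ≤ sqLen u :=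
  Finset.sum_nonneg fun _ _ => sq_nonneg _

lemma norm_sq_le_sqLen {d : ℕ} (u : Fin d → ℝ) : ‖u‖ ^ 2 ≤ sqLen u := by
  have h : ‖u‖ ≤ √(sqLen u) := by
    refine (pi_norm_le_iff_of_nonneg (Real.sqrt_nonneg _)).2 fun i => ?_
    refine Real.le_sqrt_of_sq_le ?_
    rw [Real.norm_eq_abs, sq_abs]
    exact Finset.single_le_sum (f := fun i => u i ^ 2) (fun _ _ => sq_nonneg _) (Finset.mem_univ i)
  calc ‖u‖ ^ 2 ≤ √(sqLen u) ^ 2 := by gcongr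
    _ = sqLen u := Real.sq_sqrt (sqLen_nonneg u)

lemma sqLen_le_mul_norm_sq {d : ℕ} (u : Fin d → ℝ) : sqLen u ≤ d * ‖u‖ ^ 2 := by
  calc sqLen u ≤ ∑ _i : Fin d, ‖u‖ ^ 2 := Finset.sum_le_sum fun i _ => by
        rw [← sq_abs]
        exact pow_le_pow_left₀ (abs_nonneg _) (norm_le_pi_norm u i) 2
    _ = d * ‖u‖ ^ 2 := by simp

lemma hasFDerivAt_sqLen {d : ℕ} (u : Fin d → ℝ) :
    HasFDerivAt sqLen (sqLenDeriv d u) u := by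
  have h : HasFDerivAt (fun v : Fin d → ℝ => ∑ i, v i ^ 2)
      (∑ i, (2 * u i ^ 1) • ContinuousLinearMap.proj (R := ℝ) (φ := fun _ : Fin d => ℝ) i) u := by
    refine HasFDerivAt.fun_sum fun i _ => ?_
    simpa using HasFDerivAt.pow (f := fun v : Fin d → ℝ => v i) (hasFDerivAt_apply i u) 2
  refine h.congr_fderiv ?_
  ext v
  simp [sqLenDeriv, mul_assoc]

lemma japaneseWeight_nonneg {d : ℕ} (u : Fin d → ℝ) : 0 ≤ japaneseWeight u := by
  unfold japaneseWeight; positivity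

lemma integrable_japaneseWeight_sub {d : ℕ} (x : Fin d → ℝ) :
    Integrable fun z => japaneseWeight (x - z) := by
  have h : Integrable (japaneseWeight : (Fin d → ℝ) → ℝ) := by
    refine integrable_one_add_norm ?_
    simp
  exact h.comp_sub_left x

lemma japaneseWeight_sub_le {d : ℕ} {x₀ x : Fin d → ℝ} (hx : x ∈ Metric.ball x₀ 1)
    (z : Fin d → ℝ) :
    japaneseWeight (x - z) ≤ 2 ^ ((d : ℝ) + 1) * japaneseWeight (x₀ - z) := by
  have h1 : ‖x₀ - z‖ ≤ ‖x - z‖ + 1 := by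
    have h2 : ‖x₀ - x‖ < 1 := by rwa [← dist_eq_norm, dist_comm]
    have h3 : ‖x₀ - z‖ ≤ ‖x₀ - x‖ + ‖x - z‖ := norm_sub_le_norm_sub_add_norm_sub _ _ _
    linarith
  have h4 : (1 + ‖x₀ - z‖) / 2 ≤ 1 + ‖x - z‖ := by linarith [norm_nonneg (x - z)]
  unfold japaneseWeight
  calc (1 + ‖x - z‖) ^ (-((d : ℝ) + 1)) ≤ ((1 + ‖x₀ - z‖) / 2) ^ (-((d : ℝ) + 1)) :=
        Real.rpow_le_rpow_of_nonpos (by positivity) h4 (by linarith [d.cast_nonneg (α := ℝ)])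
    _ = _ := by
        rw [Real.div_rpow (by positivity) (by norm_num), Real.rpow_neg (x := 2) (by norm_num)]
        field_simp

lemma exists_pow_mul_exp_le {d : ℕ} {a : ℝ} (ha : 0 < a) (n : ℕ) :
    ∃ C, ∀ u : Fin d → ℝ, (1 + ‖u‖) ^ n * Real.exp (-a * sqLen u) ≤ C * japaneseWeight u := by
  refine ⟨Real.exp (((n : ℝ) + d + 1) ^ 2 / (4 * a)), fun u => ?_⟩
  have h0 : 0 < 1 + ‖u‖ := by positivity
  have h1 : (1 + ‖u‖) ^ (n + d + 1) ≤ Real.exp (((n : ℝ) + d + 1) * ‖u‖) := by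
    calc (1 + ‖u‖) ^ (n + d + 1) ≤ Real.exp ‖u‖ ^ (n + d + 1) := by
          gcongr
          linarith [Real.add_one_le_exp ‖u‖]
      _ = _ := by rw [← Real.exp_nat_mul]; push_cast; rfl
  have h2 : japaneseWeight u = ((1 + ‖u‖) ^ (d + 1))⁻¹ := by
    rw [japaneseWeight, Real.rpow_neg h0.le, ← Real.rpow_natCast]
    push_cast
    rfl
  rw [h2, ← div_eq_mul_inv, le_div_iff₀ (by positivity)]
  calc (1 + ‖u‖) ^ n * Real.exp (-a * sqLen u) * (1 + ‖u‖) ^ (d + 1)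
      = (1 + ‖u‖) ^ (n + d + 1) * Real.exp (-a * sqLen u) := by ring
    _ ≤ Real.exp (((n : ℝ) + d + 1) * ‖u‖) * Real.exp (-a * ‖u‖ ^ 2) := by
        gcongr ?_ * Real.exp ?_
        nlinarith [norm_sq_le_sqLen u]
    _ = Real.exp (((n : ℝ) + d + 1) * ‖u‖ + -a * ‖u‖ ^ 2) := (Real.exp_add _ _).symm
    _ ≤ _ := by
        gcongr
        rw [le_div_iff₀ (by positivity)]
        nlinarith [sq_nonneg (2 * a * ‖u‖ - ((n : ℝ) + d + 1))]

lemma stdGaussian_eq_withDensity (d : ℕ) :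
    _root_.stdGaussian d =
      volume.withDensity fun y => ENNReal.ofReal (∏ i, gaussianPDFReal 0 1 (y i)) := by
  refine Measure.pi_eq fun s hs => ?_
  rw [withDensity_apply _ (MeasurableSet.univ_pi hs), ← ofReal_integral_eq_lintegral_ofReal,
    volume_pi, Measure.restrict_pi_pi, integral_fintype_prod_eq_prod,
    ENNReal.ofReal_prod_of_nonneg]
  · exact Finset.prod_congr rfl fun i _ =>
      (gaussianReal_apply_eq_integral 0 one_ne_zero (s i)).symm
  · exact fun i _ => integral_nonneg fun _ => gaussianPDFReal_nonneg _ _ _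
  · exact (Integrable.fintype_prod fun _ => integrable_gaussianPDFReal 0 1).integrableOn
  · exact ae_of_all _ fun y => Finset.prod_nonneg fun i _ => gaussianPDFReal_nonneg _ _ _

/-- The integral of `φ` against the Gaussian kernel `exp (-a |x - z|²)`. -/
noncomputable def gaussConv {d : ℕ} (φ : (Fin d → ℝ) → ℝ) (a : ℝ) (x : Fin d → ℝ) : ℝ :=
  ∫ z, φ z * Real.exp (-a * sqLen (x - z))

lemma integral_stdGaussian_eq_gaussConv {d : ℕ} (φ : (Fin d → ℝ) → ℝ) (x : Fin d → ℝ)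
    {r : ℝ} (hr : 0 < r) :
    ∫ y, φ (x + r • y) ∂(_root_.stdGaussian d) =
      ((√(2 * Real.pi) * r) ^ d)⁻¹ * gaussConv φ (1 / (2 * r ^ 2)) x := by
  have hp : ∀ y : Fin d → ℝ, ∏ i, gaussianPDFReal 0 1 (y i)
      = (√(2 * Real.pi) ^ d)⁻¹ * Real.exp (-(1 / 2) * sqLen y) := fun y => by
    simp only [gaussianPDFReal_def, Finset.prod_mul_distrib, ← Real.exp_sum]
    simp [sqLen, Finset.mul_sum, div_eq_inv_mul]
    rw [← inv_pow, mul_inv, mul_comm]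
  have hnn : ∀ y : Fin d → ℝ, 0 ≤ ∏ i, gaussianPDFReal 0 1 (y i) := fun y =>
    Finset.prod_nonneg fun i _ => gaussianPDFReal_nonneg _ _ _
  rw [stdGaussian_eq_withDensity, integral_withDensity_eq_integral_toReal_smul
    (by fun_prop) (ae_of_all _ fun _ => ENNReal.ofReal_lt_top)]
  simp only [ENNReal.toReal_ofReal (hnn _)]
  simp only [hp, smul_eq_mul]
  have h1 : ∀ y : Fin d → ℝ,
      (√(2 * Real.pi) ^ d)⁻¹ * Real.exp (-(1 / 2) * sqLen y) * φ (x + r • y)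
      = (fun u => (√(2 * Real.pi) ^ d)⁻¹ *
          (φ (x + u) * Real.exp (-(1 / (2 * r ^ 2)) * sqLen u))) (r • y) := fun y => by
    simp only [sqLen_smul]
    rw [show -(1 / (2 * r ^ 2)) * (r ^ 2 * sqLen y) = -(1 / 2) * sqLen y by field_simp]
    ring
  refine (integral_congr_ae (ae_of_all _ h1)).trans
    ((Measure.integral_comp_smul_of_nonneg volume (fun u => (√(2 * Real.pi) ^ d)⁻¹ *
      (φ (x + u) * Real.exp (-(1 / (2 * r ^ 2)) * sqLen u))) r (hR := hr.le)).trans ?_)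
  rw [integral_const_mul, gaussConv,
    ← integral_add_left_eq_self (fun z => φ z * Real.exp (-(1 / (2 * r ^ 2)) * sqLen (x - z))) x]
  simp [sqLen_neg, mul_pow]
  ring

section Kernel

variable {d : ℕ} {F : Type*} [NormedAddCommGroup F] [NormedSpace ℝ F]
  {φ : (Fin d → ℝ) → ℝ} {k : (Fin d → ℝ) → F}

lemma norm_smul_kernel_le {C K : ℝ} (hφb : ∀ x, |φ x| ≤ C)
    (hk : ∀ u, ‖k u‖ ≤ K * japaneseWeight u) {x₀ x : Fin d → ℝ} (hx : x ∈ Metric.ball x₀ 1)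
    (z : Fin d → ℝ) :
    ‖φ z • k (x - z)‖ ≤ C * |K| * 2 ^ ((d : ℝ) + 1) * japaneseWeight (x₀ - z) := by
  have hC : 0 ≤ C := (abs_nonneg _).trans (hφb z)
  calc ‖φ z • k (x - z)‖ = |φ z| * ‖k (x - z)‖ := by rw [norm_smul, Real.norm_eq_abs]
    _ ≤ C * (|K| * (2 ^ ((d : ℝ) + 1) * japaneseWeight (x₀ - z))) := by
        gcongr
        · exact hφb z
        · refine (hk _).trans ?_
          have h := japaneseWeight_nonneg (x - z)
          gcongr
          · exact le_abs_self K
          · exact japaneseWeight_sub_le hx z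
    _ = _ := by ring

lemma integrable_smul_kernel (hφc : Continuous φ) (hφb : ∃ C, ∀ x, |φ x| ≤ C)
    (hkc : Continuous k) (hk : ∃ K, ∀ u, ‖k u‖ ≤ K * japaneseWeight u) (x : Fin d → ℝ) :
    Integrable fun z => φ z • k (x - z) := by
  obtain ⟨C, hC⟩ := hφb
  obtain ⟨K, hK⟩ := hk
  refine ((integrable_japaneseWeight_sub x).const_mul (C * |K| * 2 ^ ((d : ℝ) + 1))).mono'
    (by fun_prop) (ae_of_all _ fun z => ?_)
  exact norm_smul_kernel_le hC hK (Metric.mem_ball_self one_pos) z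

lemma continuous_integral_smul_kernel (hφc : Continuous φ) (hφb : ∃ C, ∀ x, |φ x| ≤ C)
    (hkc : Continuous k) (hk : ∃ K, ∀ u, ‖k u‖ ≤ K * japaneseWeight u) :
    Continuous fun x => ∫ z, φ z • k (x - z) := by
  obtain ⟨C, hC⟩ := hφb
  obtain ⟨K, hK⟩ := hk
  refine continuous_iff_continuousAt.2 fun x₀ => continuousAt_of_dominated
    (bound := fun z => C * |K| * 2 ^ ((d : ℝ) + 1) * japaneseWeight (x₀ - z)) ?_ ?_ ?_ ?_
  · exact Filter.Eventually.of_forall fun x => by fun_prop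
  · filter_upwards [Metric.ball_mem_nhds x₀ one_pos] with x hx
    exact ae_of_all _ (norm_smul_kernel_le hC hK hx)
  · exact (integrable_japaneseWeight_sub x₀).const_mul _
  · exact ae_of_all _ fun z => by fun_prop

lemma hasFDerivAt_integral_smul_kernel {k' : (Fin d → ℝ) → (Fin d → ℝ) →L[ℝ] F}
    (hφc : Continuous φ) (hφb : ∃ C, ∀ x, |φ x| ≤ C)
    (hk : ∃ K, ∀ u, ‖k u‖ ≤ K * japaneseWeight u)
    (hkk' : ∀ u, HasFDerivAt k (k' u) u) (hk'c : Continuous k')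
    (hk' : ∃ K, ∀ u, ‖k' u‖ ≤ K * japaneseWeight u) (x₀ : Fin d → ℝ) :
    HasFDerivAt (fun x => ∫ z, φ z • k (x - z)) (∫ z, φ z • k' (x₀ - z)) x₀ := by
  have hkc : Continuous k := continuous_iff_continuousAt.2 fun u => (hkk' u).continuousAt
  have hint := integrable_smul_kernel hφc hφb hkc hk x₀
  obtain ⟨C, hC⟩ := hφb
  obtain ⟨K, hK⟩ := hk'
  refine hasFDerivAt_integral_of_dominated_of_fderiv_le (F' := fun x z => φ z • k' (x - z))
    (bound := fun z => C * |K| * 2 ^ ((d : ℝ) + 1) * japaneseWeight (x₀ - z))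
    (Metric.ball_mem_nhds x₀ one_pos) ?_ hint ?_ ?_ ?_ ?_
  · exact Filter.Eventually.of_forall fun x => by fun_prop
  · have : Continuous fun z => φ z • k' (x₀ - z) := by fun_prop
    exact this.aestronglyMeasurable
  · exact ae_of_all _ fun z x hx => norm_smul_kernel_le hC hK hx z
  · exact (integrable_japaneseWeight_sub x₀).const_mul _
  · refine ae_of_all _ fun z x _ => HasFDerivAt.const_smul ?_ (φ z)
    exact (hkk' (x - z)).comp x ((hasFDerivAt_id x).sub_const z)

end Kernel

section ExpHessian

set_option maxSynthPendingDepth 3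

variable {V : Type*} [NormedAddCommGroup V] [NormedSpace ℝ V]

/-- The Hessian at `u` of the exponential of a quadratic form, where the quadratic form has
derivative `M` and its exponential has value `e` at `u`. -/
noncomputable def expHessian (M : V →L[ℝ] V →L[ℝ] ℝ) (e : ℝ) (u : V) : V →L[ℝ] V →L[ℝ] ℝ :=
  e • (M + (M u).smulRight (M u))

lemma continuous_expHessian (M : V →L[ℝ] V →L[ℝ] ℝ) {e : V → ℝ} (he : Continuous e) :
    Continuous fun u => expHessian M (e u) u := by
  have h : Continuous fun u => (M u).smulRight (M u) :=
    ((ContinuousLinearMap.smulRightL ℝ V (V →L[ℝ] ℝ)).continuous.comp M.continuous).clm_apply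
      M.continuous
  exact he.smul (continuous_const.add h)

lemma norm_expHessian_le (M : V →L[ℝ] V →L[ℝ] ℝ) (e : ℝ) (u : V) :
    ‖expHessian M e u‖ ≤ (‖M‖ + ‖M‖ ^ 2) * ((1 + ‖u‖) ^ 2 * |e|) := by
  have hM := norm_nonneg M
  rw [expHessian, norm_smul, Real.norm_eq_abs, mul_comm, ← mul_assoc]
  gcongr
  have h1 : ‖M u‖ ≤ ‖M‖ * ‖u‖ := M.le_opNorm u
  have h2 : ‖M u‖ ^ 2 ≤ (‖M‖ * ‖u‖) ^ 2 := by gcongr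
  refine (norm_add_le _ _).trans ?_
  rw [ContinuousLinearMap.norm_smulRight_apply]
  have h3 := norm_nonneg u
  nlinarith [mul_nonneg hM h3, mul_nonneg hM (sq_nonneg ‖u‖), mul_nonneg (sq_nonneg ‖M‖) h3]

end ExpHessian

/-- The linear map `u ↦ -a • D sqLen u`, the logarithmic derivative of the Gaussian kernel. -/
noncomputable def gaussLogDeriv (d : ℕ) (a : ℝ) : (Fin d → ℝ) →L[ℝ] (Fin d → ℝ) →L[ℝ] ℝ :=
  (-a) • sqLenDeriv d

/-- The derivative of the Gaussian kernel. -/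
noncomputable def gaussKernelDeriv {d : ℕ} (a : ℝ) (u : Fin d → ℝ) : (Fin d → ℝ) →L[ℝ] ℝ :=
  Real.exp (-a * sqLen u) • gaussLogDeriv d a u

/-- The second derivative of the Gaussian kernel. -/
noncomputable def gaussKernelDeriv₂ {d : ℕ} (a : ℝ) (u : Fin d → ℝ) :
    (Fin d → ℝ) →L[ℝ] (Fin d → ℝ) →L[ℝ] ℝ :=
  expHessian (gaussLogDeriv d a) (Real.exp (-a * sqLen u)) u

lemma hasFDerivAt_gaussKernel {d : ℕ} (a : ℝ) (u : Fin d → ℝ) :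
    HasFDerivAt (fun v => Real.exp (-a * sqLen v)) (gaussKernelDeriv a u) u :=
  ((hasFDerivAt_sqLen u).const_mul (-a)).exp

lemma hasFDerivAt_gaussKernelDeriv {d : ℕ} (a : ℝ) (u : Fin d → ℝ) :
    HasFDerivAt (gaussKernelDeriv a) (gaussKernelDeriv₂ a u) u := by
  refine ((hasFDerivAt_gaussKernel a u).smul (gaussLogDeriv d a).hasFDerivAt).congr_fderiv ?_
  ext v v'
  simp [gaussKernelDeriv, gaussKernelDeriv₂, expHessian]
  ring

lemma continuous_gaussKernelDeriv {d : ℕ} (a : ℝ) :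
    Continuous (gaussKernelDeriv a : (Fin d → ℝ) → _) :=
  continuous_iff_continuousAt.2 fun u => (hasFDerivAt_gaussKernelDeriv a u).continuousAt

lemma continuous_gaussKernelDeriv₂ {d : ℕ} (a : ℝ) :
    Continuous (gaussKernelDeriv₂ a : (Fin d → ℝ) → _) := by
  have h := continuous_sqLen (d := d)
  exact continuous_expHessian _ (continuous_const.mul h).rexp

lemma exists_norm_le_japaneseWeight_of_le {d : ℕ} {F : Type*} [NormedAddCommGroup F]
    {k : (Fin d → ℝ) → F} {a : ℝ} (ha : 0 < a) (n : ℕ) {M : ℝ} (hM : 0 ≤ M)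
    (hk : ∀ u, ‖k u‖ ≤ M * ((1 + ‖u‖) ^ n * Real.exp (-a * sqLen u))) :
    ∃ K, ∀ u, ‖k u‖ ≤ K * japaneseWeight u := by
  obtain ⟨C, hC⟩ := exists_pow_mul_exp_le (d := d) ha n
  refine ⟨M * C, fun u => (hk u).trans ?_⟩
  rw [mul_assoc]
  exact mul_le_mul_of_nonneg_left (hC u) hM

lemma exists_norm_gaussKernel_le {d : ℕ} {a : ℝ} (ha : 0 < a) :
    ∃ K, ∀ u : Fin d → ℝ, ‖Real.exp (-a * sqLen u)‖ ≤ K * japaneseWeight u :=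
  exists_norm_le_japaneseWeight_of_le ha 0 zero_le_one fun u => by simp

lemma exists_norm_sqLen_mul_gaussKernel_le {d : ℕ} {a : ℝ} (ha : 0 < a) :
    ∃ K, ∀ u : Fin d → ℝ, ‖sqLen u * Real.exp (-a * sqLen u)‖ ≤ K * japaneseWeight u := by
  refine exists_norm_le_japaneseWeight_of_le ha 2 d.cast_nonneg fun u => ?_
  rw [norm_mul, Real.norm_of_nonneg (sqLen_nonneg u), Real.norm_of_nonneg (Real.exp_pos _).le,
    ← mul_assoc]
  gcongr
  refine (sqLen_le_mul_norm_sq u).trans ?_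
  gcongr
  linarith

lemma exists_norm_gaussKernelDeriv_le {d : ℕ} {a : ℝ} (ha : 0 < a) :
    ∃ K, ∀ u : Fin d → ℝ, ‖gaussKernelDeriv a u‖ ≤ K * japaneseWeight u := by
  refine exists_norm_le_japaneseWeight_of_le ha 1 (norm_nonneg (gaussLogDeriv d a)) fun u => ?_
  rw [gaussKernelDeriv, norm_smul, Real.norm_of_nonneg (Real.exp_pos _).le, mul_comm, ← mul_assoc,
    pow_one]
  gcongr
  refine ((gaussLogDeriv d a).le_opNorm u).trans ?_
  gcongr
  linarith

lemma exists_norm_gaussKernelDeriv₂_le {d : ℕ} {a : ℝ} (ha : 0 < a) :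
    ∃ K, ∀ u : Fin d → ℝ, ‖gaussKernelDeriv₂ a u‖ ≤ K * japaneseWeight u := by
  have hM := norm_nonneg (gaussLogDeriv d a)
  refine exists_norm_le_japaneseWeight_of_le (k := gaussKernelDeriv₂ a) ha 2
    (M := ‖gaussLogDeriv d a‖ + ‖gaussLogDeriv d a‖ ^ 2) (by positivity) fun u => ?_
  refine (norm_expHessian_le _ _ u).trans_eq ?_
  rw [abs_of_pos (Real.exp_pos _)]

section GaussConv

variable {d : ℕ} {φ : (Fin d → ℝ) → ℝ} {a : ℝ}

lemma continuous_gaussKernel (a : ℝ) :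
    Continuous fun u : Fin d → ℝ => Real.exp (-a * sqLen u) := by
  have h := continuous_sqLen (d := d)
  fun_prop

lemma hasFDerivAt_gaussConv (hφc : Continuous φ) (hφb : ∃ C, ∀ x, |φ x| ≤ C) (ha : 0 < a)
    (x : Fin d → ℝ) :
    HasFDerivAt (gaussConv φ a) (∫ z, φ z • gaussKernelDeriv a (x - z)) x :=
  hasFDerivAt_integral_smul_kernel hφc hφb (exists_norm_gaussKernel_le ha)
    (hasFDerivAt_gaussKernel a) (continuous_gaussKernelDeriv a)
    (exists_norm_gaussKernelDeriv_le ha) x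

lemma hasFDerivAt_integral_gaussKernelDeriv (hφc : Continuous φ) (hφb : ∃ C, ∀ x, |φ x| ≤ C)
    (ha : 0 < a) (x : Fin d → ℝ) :
    HasFDerivAt (fun x => ∫ z, φ z • gaussKernelDeriv a (x - z))
      (∫ z, φ z • gaussKernelDeriv₂ a (x - z)) x :=
  hasFDerivAt_integral_smul_kernel hφc hφb (exists_norm_gaussKernelDeriv_le ha)
    (hasFDerivAt_gaussKernelDeriv a) (continuous_gaussKernelDeriv₂ a)
    (exists_norm_gaussKernelDeriv₂_le ha) x

lemma contDiff_two_gaussConv (hφc : Continuous φ) (hφb : ∃ C, ∀ x, |φ x| ≤ C) (ha : 0 < a) :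
    ContDiff ℝ 2 (gaussConv φ a) := by
  refine (contDiff_succ_iff_hasFDerivAt (n := 1)).2
    ⟨fun x => ∫ z, φ z • gaussKernelDeriv a (x - z), ?_, fun x => hasFDerivAt_gaussConv hφc hφb ha x⟩
  refine contDiff_one_iff_hasFDerivAt.2
    ⟨fun x => ∫ z, φ z • gaussKernelDeriv₂ a (x - z), ?_,
      fun x => hasFDerivAt_integral_gaussKernelDeriv hφc hφb ha x⟩
  exact continuous_integral_smul_kernel hφc hφb (continuous_gaussKernelDeriv₂ a)
    (exists_norm_gaussKernelDeriv₂_le ha)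

lemma sum_gaussKernelDeriv₂_single (a : ℝ) (u : Fin d → ℝ) :
    ∑ i, gaussKernelDeriv₂ a u (Pi.single i 1) (Pi.single i 1) =
      4 * a ^ 2 * (sqLen u * Real.exp (-a * sqLen u)) -
        2 * a * d * Real.exp (-a * sqLen u) := by
  have h : ∀ i, gaussKernelDeriv₂ a u (Pi.single i 1) (Pi.single i 1) =
      Real.exp (-a * sqLen u) * (-a * 2 + 4 * a ^ 2 * u i ^ 2) := fun i => by
    simp [gaussKernelDeriv₂, expHessian, gaussLogDeriv, sqLenDeriv_apply, Pi.single_apply]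
    ring
  simp only [h, ← Finset.mul_sum, Finset.sum_add_distrib]
  simp [sqLen]
  ring

lemma lap'_gaussConv (hφc : Continuous φ) (hφb : ∃ C, ∀ x, |φ x| ≤ C) (ha : 0 < a)
    (x : Fin d → ℝ) :
    lap' d (gaussConv φ a) x =
      4 * a ^ 2 * (∫ z, φ z * (sqLen (x - z) * Real.exp (-a * sqLen (x - z)))) -
        2 * a * d * gaussConv φ a x := by
  have hint := integrable_smul_kernel (k := gaussKernelDeriv₂ a) hφc hφb
    (continuous_gaussKernelDeriv₂ a)
    (exists_norm_gaussKernelDeriv₂_le ha) x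
  have h2 : ∀ i : Fin d,
      fderiv ℝ (fun y => fderiv ℝ (gaussConv φ a) y (Pi.single i 1)) x (Pi.single i 1) =
      ∫ z, φ z * gaussKernelDeriv₂ a (x - z) (Pi.single i 1) (Pi.single i 1) := fun i => by
    simp only [fun y => (hasFDerivAt_gaussConv hφc hφb ha y).fderiv]
    rw [((hasFDerivAt_integral_gaussKernelDeriv hφc hφb ha x).clm_apply
      (hasFDerivAt_const (Pi.single i 1) x)).fderiv]
    simp only [ContinuousLinearMap.comp_zero, zero_add, ContinuousLinearMap.flip_apply]
    rw [ContinuousLinearMap.integral_apply hint,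
      ContinuousLinearMap.integral_apply (hint.apply_continuousLinearMap _)]
    rfl
  have h3 : ∀ i : Fin d, Integrable fun z =>
      φ z * gaussKernelDeriv₂ a (x - z) (Pi.single i 1) (Pi.single i 1) := fun i =>
    (hint.apply_continuousLinearMap (Pi.single i 1)).apply_continuousLinearMap (Pi.single i 1)
  have h4 : Integrable fun z => φ z * (sqLen (x - z) * Real.exp (-a * sqLen (x - z))) :=
    integrable_smul_kernel (k := fun u => sqLen u * Real.exp (-a * sqLen u)) hφc hφb
      (continuous_sqLen.mul (continuous_gaussKernel a))
      (exists_norm_sqLen_mul_gaussKernel_le ha) x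
  have h5 : Integrable fun z => φ z * Real.exp (-a * sqLen (x - z)) :=
    integrable_smul_kernel (k := fun u => Real.exp (-a * sqLen u)) hφc hφb
      (continuous_gaussKernel a) (exists_norm_gaussKernel_le ha) x
  simp only [lap', h2]
  rw [← integral_finsetSum _ fun i _ => h3 i, gaussConv, ← integral_const_mul,
    ← integral_const_mul, ← integral_sub (h4.const_mul _) (h5.const_mul _)]
  refine integral_congr_ae (ae_of_all _ fun z => ?_)
  simp only [← Finset.mul_sum, sum_gaussKernelDeriv₂_single]
  ring

lemma hasDerivAt_gaussConv_param (hφc : Continuous φ) (hφb : ∃ C, ∀ x, |φ x| ≤ C) (ha : 0 < a)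
    (x : Fin d → ℝ) :
    HasDerivAt (fun b => gaussConv φ b x)
      (-∫ z, φ z * (sqLen (x - z) * Real.exp (-a * sqLen (x - z)))) a := by
  have hint := integrable_smul_kernel hφc hφb (continuous_gaussKernel a)
    (exists_norm_gaussKernel_le ha) x
  have hQ := continuous_sqLen (d := d)
  have hdom := (integrable_smul_kernel (k := fun u => sqLen u * Real.exp (-(a / 2) * sqLen u))
    hφc hφb (hQ.mul (continuous_gaussKernel (a / 2)))
    (exists_norm_sqLen_mul_gaussKernel_le (half_pos ha)) x).norm
  rw [← integral_neg]
  refine (hasDerivAt_integral_of_dominated_loc_of_deriv_le (s := Set.Ioi (a / 2))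
    (F' := fun b z => -(φ z * (sqLen (x - z) * Real.exp (-b * sqLen (x - z)))))
    (Ioi_mem_nhds (half_lt_self ha)) ?_ hint ?_ ?_ hdom ?_).2
  · exact Filter.Eventually.of_forall fun b => by fun_prop
  · fun_prop
  · refine ae_of_all _ fun z b hb => ?_
    have hq := sqLen_nonneg (x - z)
    rw [norm_neg, norm_mul, norm_smul, norm_mul, norm_mul, Real.norm_of_nonneg (Real.exp_pos _).le,
      Real.norm_of_nonneg (Real.exp_pos _).le]
    gcongr
    exact (Set.mem_Ioi.1 hb).le
  · refine ae_of_all _ fun z b _ => ?_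
    have h := (((hasDerivAt_id b).neg.mul_const (sqLen (x - z))).exp).const_mul (φ z)
    refine h.congr_deriv ?_
    simp only [Pi.neg_apply, id]
    ring

end GaussConv

lemma lap'_const_mul {d : ℕ} (c : ℝ) (f : (Fin d → ℝ) → ℝ) (x : Fin d → ℝ) :
    lap' d (fun y => c * f y) x = c * lap' d f x := by
  have h : ∀ (g : (Fin d → ℝ) → ℝ) (y : Fin d → ℝ),
      fderiv ℝ (fun y => c * g y) y = c • fderiv ℝ g y := fun g y =>
    congrFun (fderiv_const_smul_field (𝕜 := ℝ) (f := g) c) y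
  simp [lap', h, Finset.mul_sum]

lemma hasDerivAt_inv_pow {r : ℝ} (hr : r ≠ 0) (n : ℕ) :
    HasDerivAt (fun r : ℝ => (r ^ n)⁻¹) (-n * (r ^ n)⁻¹ / r) r := by
  have h := hasDerivAt_zpow (-(n : ℤ)) r (Or.inl hr)
  simp only [zpow_neg, zpow_natCast] at h
  refine h.congr_deriv ?_
  rw [zpow_sub_one₀ hr, zpow_neg, zpow_natCast]
  push_cast
  ring

lemma hasDerivAt_integral_stdGaussian {d : ℕ} {φ : (Fin d → ℝ) → ℝ} (hφc : Continuous φ)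
    (hφb : ∃ C, ∀ x, |φ x| ≤ C) {T σ t : ℝ} (hσ : 0 < σ) (ht : t < T) (x : Fin d → ℝ) :
    HasDerivAt (fun s => ∫ y, φ (x + (σ * √(T - s)) • y) ∂(_root_.stdGaussian d))
      (-(σ ^ 2 / 2 * lap' d
        (fun x => ∫ y, φ (x + (σ * √(T - t)) • y) ∂(_root_.stdGaussian d)) x)) t := by
  have hpos : ∀ s < T, 0 < σ * √(T - s) := fun s hs =>
    mul_pos hσ (Real.sqrt_pos.2 (sub_pos.2 hs))
  have hr : HasDerivAt (fun s => σ * √(T - s)) (-σ ^ 2 / (2 * (σ * √(T - t)))) t := by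
    refine ((((hasDerivAt_id t).const_sub T).sqrt (sub_pos.2 ht).ne').const_mul σ).congr_deriv ?_
    have := Real.sqrt_pos.2 (sub_pos.2 ht)
    simp only [id]
    field_simp
  simp only [integral_stdGaussian_eq_gaussConv φ _ (hpos t ht)]
  have hev : (fun s => ∫ y, φ (x + (σ * √(T - s)) • y) ∂(_root_.stdGaussian d)) =ᶠ[nhds t]
      fun s => ((√(2 * Real.pi) * (σ * √(T - s))) ^ d)⁻¹ *
        gaussConv φ (1 / (2 * (σ * √(T - s)) ^ 2)) x := by
    filter_upwards [Iio_mem_nhds ht] with s hs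
    exact integral_stdGaussian_eq_gaussConv φ x (hpos s hs)
  refine HasDerivAt.congr_of_eventuallyEq ?_ hev
  have hr0 := hpos t ht
  set r := σ * √(T - t) with hrdef
  have hπ : 0 < √(2 * Real.pi) := by positivity
  have ha : 0 < 1 / (2 * r ^ 2) := by positivity
  have hinv : HasDerivAt (fun s => 1 / (2 * (σ * √(T - s)) ^ 2)) (σ ^ 2 / (2 * r ^ 4)) t := by
    have h := ((hr.pow 2).const_mul 2).inv (by simp [← hrdef]; positivity)
    simp only [one_div]
    refine h.congr_deriv ?_
    simp [← hrdef]
    field_simp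
  have hc := (hasDerivAt_inv_pow (mul_pos hπ hr0).ne' d).comp t (hr.const_mul (√(2 * Real.pi)))
  have hG := (hasDerivAt_gaussConv_param hφc hφb ha x).comp t hinv
  refine (hc.mul hG).congr_deriv ?_
  rw [lap'_const_mul, lap'_gaussConv hφc hφb ha]
  simp only [Function.comp, ← hrdef]
  field_simp
  ring

/-- The Gaussian average `w(t,x) = E[φ(x + σ√(T−t) ξ)]` is continuous on `[0,T] × ℝ^d`,
is a classical solution of the terminal-value heat equation `∂_t w + (σ²/2) Δ w = 0` on
`[0,T) × ℝ^d`, and satisfies `w(T,·) = φ`. -/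
theorem gaussian_average_solves_heat_equation
    (d : ℕ) (T σ : ℝ) (hT : 0 < T) (hσ : 0 < σ)
    (φ : (Fin d → ℝ) → ℝ) (hφc : Continuous φ) (hφb : ∃ C, ∀ x, |φ x| ≤ C)
    (w : ℝ → (Fin d → ℝ) → ℝ)
    (hw : w = fun t x => ∫ y, φ (x + (σ * Real.sqrt (T - t)) • y) ∂(stdGaussian d)) :
    ContinuousOn (fun p : ℝ × (Fin d → ℝ) => w p.1 p.2) (Set.Icc 0 T ×ˢ Set.univ) ∧
    (∀ t ∈ Set.Ico (0 : ℝ) T, ∀ x : Fin d → ℝ, DifferentiableAt ℝ (fun s => w s x) t) ∧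
    (∀ t ∈ Set.Ico (0 : ℝ) T, ContDiff ℝ 2 fun x => w t x) ∧
    (∀ t ∈ Set.Ico (0 : ℝ) T, ∀ x : Fin d → ℝ,
      deriv (fun s => w s x) t + σ ^ 2 / 2 * lap' d (w t) x = 0) ∧
    (∀ x : Fin d → ℝ, w T x = φ x) := by
  subst hw
  obtain ⟨C, hC⟩ := hφb
  have hprob : IsProbabilityMeasure (_root_.stdGaussian d) := by
    unfold _root_.stdGaussian
    infer_instance
  refine ⟨?_, fun t ht x => ?_, fun t ht => ?_, fun t ht x => ?_, fun x => by simp⟩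
  · refine Continuous.continuousOn ?_
    refine continuous_of_dominated (bound := fun _ => C) (fun p => ?_)
      (fun p => ae_of_all _ fun y => hC _) (integrable_const C) (ae_of_all _ fun y => ?_)
    · have : Continuous fun y : Fin d → ℝ => φ (p.2 + (σ * √(T - p.1)) • y) := by fun_prop
      exact this.aestronglyMeasurable
    · fun_prop
  · exact (hasDerivAt_integral_stdGaussian hφc ⟨C, hC⟩ hσ ht.2 x).differentiableAt
  · have hr : 0 < σ * √(T - t) := mul_pos hσ (Real.sqrt_pos.2 (sub_pos.2 ht.2))
    simp only [integral_stdGaussian_eq_gaussConv φ _ hr]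
    exact contDiff_const.mul (contDiff_two_gaussConv hφc ⟨C, hC⟩ (by positivity))
  · rw [(hasDerivAt_integral_stdGaussian hφc ⟨C, hC⟩ hσ ht.2 x).deriv]
    exact neg_add_cancel _
end

section
/- Let d ∈ ℕ, T > 0, α > 0, β > 0, and let g : ℝ^d → ℝ be bounded and continuous. Let γ^d be the standard Gaussian measure on ℝ^d (the d-fold product of the Gaussian measure on ℝ with mean 0 and variance 1). Define v : [0,T] × ℝ^d → ℝ by v(t,x) := (α/(2β)) log ( ∫_{ℝ^d} exp( (2β/α) g(x + √(2α(T−t))·y) ) dγ^d(y) ). Then v is continuous on [0,T] × ℝ^d, v is differentiable in t and twice continuously differentiable in x on [0,T) × ℝ^d, v satisfies ∂_t v(t,x) + α Δ_x v(t,x) + 2β ‖∇_x v(t,x)‖² = 0 for all (t,x) ∈ [0,T) × ℝ^d, and v(T,x) = g(x) for all x ∈ ℝ^d. -/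
open MeasureTheory ProbabilityTheory

/-- The `i`-th partial derivative of `f : ℝ^d → ℝ` at `x`. -/
noncomputable def pderiv' (d : ℕ) (f : (Fin d → ℝ) → ℝ) (x : Fin d → ℝ) (i : Fin d) : ℝ :=
  fderiv ℝ f x (Pi.single i 1)

/-- Product Gaussian measures with variance `v` have the product density. -/
lemma pi_gaussianReal_eq_withDensity (d : ℕ) (m : Fin d → ℝ) {v : NNReal} (hv : v ≠ 0) :
    Measure.pi (fun i => gaussianReal (m i) v) =
      volume.withDensity fun z => ENNReal.ofReal (∏ i, gaussianPDFReal (m i) v (z i)) := by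
  refine Measure.pi_eq fun s hs => ?_
  have hint : Integrable (fun z : Fin d → ℝ => ∏ i, gaussianPDFReal (m i) v (z i)) :=
    Integrable.fintype_prod_dep fun i => integrable_gaussianPDFReal (m i) v
  rw [withDensity_apply _ (MeasurableSet.univ_pi hs),
    ← ofReal_integral_eq_lintegral_ofReal hint.integrableOn
      (Filter.Eventually.of_forall fun z =>
        Finset.prod_nonneg fun i _ => gaussianPDFReal_nonneg _ _ _),
    volume_pi, Measure.restrict_pi_pi,
    integral_fintype_prod_eq_prod (fun i z => gaussianPDFReal (m i) v z),
    ENNReal.ofReal_prod_of_nonneg]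
  · exact Finset.prod_congr rfl fun i _ => (gaussianReal_apply_eq_integral (m i) hv (s i)).symm
  · exact fun i _ => integral_nonneg fun z => gaussianPDFReal_nonneg _ _ _

/-- The exponential weight `exp (-a ‖z‖² + ⟨b, z⟩)` with parameters `p = (a, b)`. -/
noncomputable def gaussWeight {d : ℕ} (p : ℝ × (Fin d → ℝ)) (z : Fin d → ℝ) : ℝ :=
  Real.exp (-p.1 * ∑ i, z i ^ 2 + ∑ i, p.2 i * z i)

/-- The exponential integral of `h` with parameters `p = (a, b)`. -/
noncomputable def gaussTransform {d : ℕ} (h : (Fin d → ℝ) → ℝ) (p : ℝ × (Fin d → ℝ)) : ℝ :=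
  ∫ z, h z * gaussWeight p z

/-- Functions which are integrable against every centred Gaussian weight. -/
def GaussIntegrable {d : ℕ} (h : (Fin d → ℝ) → ℝ) : Prop :=
  ∀ ε : ℝ, 0 < ε → Integrable fun z => h z * Real.exp (-ε * ∑ i, z i ^ 2)

lemma integral_stdGaussian_comp_add_smul {d : ℕ} (f : (Fin d → ℝ) → ℝ) (x : Fin d → ℝ) {s : ℝ}
    (hs : 0 < s) :
    ∫ y, f (x + Real.sqrt s • y) ∂(stdGaussian d) =
      (Real.sqrt (2 * Real.pi * s))⁻¹ ^ d * Real.exp (-(∑ i, x i ^ 2) / (2 * s)) *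
        gaussTransform f ((2 * s)⁻¹, fun i => x i / s) := by
  have hv : s.toNNReal ≠ 0 := by simpa using hs
  have hvs : (s.toNNReal : ℝ) = s := Real.coe_toNNReal s hs.le
  have hr : Real.sqrt s ≠ 0 := (Real.sqrt_pos.2 hs).ne'
  have hmap : (stdGaussian d).map (fun y => x + Real.sqrt s • y) =
      Measure.pi fun i => gaussianReal (x i) s.toNNReal := by
    have h1 : ∀ i, (gaussianReal 0 1).map (fun y => x i + Real.sqrt s * y) =
        gaussianReal (x i) s.toNNReal := by
      intro i
      have : (fun y => x i + Real.sqrt s * y) = (x i + ·) ∘ (Real.sqrt s * ·) := rfl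
      rw [this, ← Measure.map_map (by fun_prop) (by fun_prop), gaussianReal_map_const_mul,
        gaussianReal_map_const_add]
      congr 1
      · ring
      · ext
        simp [Real.sq_sqrt hs.le, hs.le]
    have : ∀ i, SigmaFinite ((gaussianReal 0 1).map (fun y => x i + Real.sqrt s * y)) := by
      intro i
      rw [h1 i]
      infer_instance
    have h2 := Measure.pi_map_pi (μ := fun _ : Fin d => gaussianReal 0 1)
      (f := fun i y => x i + Real.sqrt s * y) (fun i => by fun_prop)
    simp_rw [h1] at h2
    exact h2
  have he : MeasurableEmbedding fun y : Fin d → ℝ => x + Real.sqrt s • y :=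
    ((Homeomorph.smulOfNeZero _ hr).trans (Homeomorph.addLeft x)).measurableEmbedding
  rw [← he.integral_map, hmap, pi_gaussianReal_eq_withDensity d x hv,
    integral_withDensity_eq_integral_toReal_smul₀, gaussTransform, ← integral_const_mul]
  · refine integral_congr_ae (Filter.Eventually.of_forall fun z => ?_)
    have hnn : 0 ≤ ∏ i, gaussianPDFReal (x i) s.toNNReal (z i) :=
      Finset.prod_nonneg fun i _ => gaussianPDFReal_nonneg _ _ _
    simp only [ENNReal.toReal_ofReal hnn, smul_eq_mul]
    simp only [gaussianPDFReal, hvs, Finset.prod_mul_distrib, Finset.prod_const, Finset.card_univ,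
      Fintype.card_fin, ← Real.exp_sum, gaussWeight]
    have : ∑ i, -(z i - x i) ^ 2 / (2 * s) = -(∑ i, x i ^ 2) / (2 * s) +
        (-(2 * s)⁻¹ * ∑ i, z i ^ 2 + ∑ i, x i / s * z i) := by
      rw [← Finset.sum_neg_distrib, Finset.sum_div, Finset.mul_sum, ← Finset.sum_add_distrib,
        ← Finset.sum_add_distrib]
      refine Finset.sum_congr rfl fun i _ => ?_
      field_simp
      ring
    rw [this, Real.exp_add]
    ring
  · have : Measurable fun z : Fin d → ℝ => ∏ i, gaussianPDFReal (x i) s.toNNReal (z i) :=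
      Finset.measurable_fun_prod _ fun i _ =>
        (measurable_gaussianPDFReal _ _).comp (measurable_pi_apply i)
    exact this.ennreal_ofReal.aemeasurable
  · exact Filter.Eventually.of_forall fun z => ENNReal.ofReal_lt_top

lemma GaussIntegrable.of_bounded {d : ℕ} {f : (Fin d → ℝ) → ℝ} (hf : Continuous f) {C : ℝ}
    (hC : ∀ z, |f z| ≤ C) : GaussIntegrable f := by
  intro ε hε
  refine Integrable.bdd_mul (c := C) ?_ hf.aestronglyMeasurable
    (Filter.Eventually.of_forall fun z => by simpa using hC z)
  have := Integrable.fintype_prod (ι := Fin d) (μ := fun _ => volume)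
    (f := fun _ x => Real.exp (-ε * x ^ 2)) (fun _ => integrable_exp_neg_mul_sq hε)
  simpa [Finset.mul_sum, ← Real.exp_sum, volume_pi] using this

lemma GaussIntegrable.mul_of_le {d : ℕ} {h q : (Fin d → ℝ) → ℝ} (hh : GaussIntegrable h)
    (hq : Continuous q) {A B : ℝ} (hA : 0 ≤ A) (hB : 0 ≤ B)
    (hle : ∀ z, |q z| ≤ A + B * ∑ i, z i ^ 2) :
    GaussIntegrable fun z => h z * q z := by
  intro ε hε
  have h1 : Integrable fun z => (h z * Real.exp (-(ε / 2) * ∑ i, z i ^ 2)) *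
      (q z * Real.exp (-(ε / 2) * ∑ i, z i ^ 2)) := by
    refine Integrable.mul_bdd (c := A + B * (2 / ε)) (hh _ (by positivity)) ?_
      (Filter.Eventually.of_forall fun z => ?_)
    · exact Continuous.aestronglyMeasurable (by fun_prop)
    · set S := ∑ i, z i ^ 2 with hS
      have hS0 : 0 ≤ S := Finset.sum_nonneg fun i _ => sq_nonneg _
      rw [Real.norm_eq_abs, abs_mul, Real.abs_exp]
      have e1 : Real.exp (-(ε / 2) * S) ≤ 1 := Real.exp_le_one_iff.2 (by nlinarith)
      have e2 : S * Real.exp (-(ε / 2) * S) ≤ 2 / ε := by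
        rw [neg_mul, Real.exp_neg, ← div_eq_mul_inv, div_le_iff₀ (Real.exp_pos _)]
        have := Real.add_one_le_exp (ε / 2 * S)
        calc S = 2 / ε * (ε / 2 * S) := by field_simp
          _ ≤ _ := by gcongr; linarith
      calc |q z| * Real.exp (-(ε / 2) * S) ≤ (A + B * S) * Real.exp (-(ε / 2) * S) := by
            gcongr; exact hle z
        _ = A * Real.exp (-(ε / 2) * S) + B * (S * Real.exp (-(ε / 2) * S)) := by ring
        _ ≤ A * 1 + B * (2 / ε) := by gcongr
        _ = _ := by ring
  refine h1.congr (Filter.Eventually.of_forall fun z => ?_)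
  have : Real.exp (-ε * ∑ i, z i ^ 2) =
      Real.exp (-(ε / 2) * ∑ i, z i ^ 2) * Real.exp (-(ε / 2) * ∑ i, z i ^ 2) := by
    rw [← Real.exp_add]; ring_nf
  simp only [this]
  ring

lemma GaussIntegrable.mul_sum_sq {d : ℕ} {h : (Fin d → ℝ) → ℝ} (hh : GaussIntegrable h) :
    GaussIntegrable fun z => h z * ∑ i, z i ^ 2 :=
  hh.mul_of_le (by fun_prop) le_rfl zero_le_one fun z => by
    rw [abs_of_nonneg (Finset.sum_nonneg fun i _ => sq_nonneg _)]; simp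

lemma abs_le_one_add_sq (x : ℝ) : |x| ≤ 1 + x ^ 2 := by
  rw [abs_le]; constructor <;> nlinarith [sq_nonneg (x - 1), sq_nonneg (x + 1)]

lemma GaussIntegrable.mul_coord {d : ℕ} {h : (Fin d → ℝ) → ℝ} (hh : GaussIntegrable h)
    (i : Fin d) : GaussIntegrable fun z => h z * z i :=
  hh.mul_of_le (by fun_prop) zero_le_one zero_le_one fun z => by
    have : z i ^ 2 ≤ ∑ j, z j ^ 2 := Finset.single_le_sum (f := fun i => z i ^ 2) (fun i _ => sq_nonneg _)
      (Finset.mem_univ i)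
    have h2 := abs_le_one_add_sq (z i)
    linarith

/-- A Gaussian weight is dominated by a centred one, locally uniformly in the parameters. -/
lemma gaussWeight_le {d : ℕ} {p : ℝ × (Fin d → ℝ)} {ε B : ℝ} (hε : 0 < ε) (hp : 2 * ε ≤ p.1)
    (hB : ∀ i, |p.2 i| ≤ B) (z : Fin d → ℝ) :
    gaussWeight p z ≤
      Real.exp (d * (B ^ 2 / (4 * ε))) * Real.exp (-ε * ∑ i, z i ^ 2) := by
  rw [gaussWeight, ← Real.exp_add, Real.exp_le_exp]
  have : (d : ℝ) * (B ^ 2 / (4 * ε)) = ∑ _i : Fin d, B ^ 2 / (4 * ε) := by simp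
  rw [this, Finset.mul_sum, Finset.mul_sum, ← Finset.sum_add_distrib, ← Finset.sum_add_distrib]
  refine Finset.sum_le_sum fun i _ => ?_
  have h1 : p.2 i * z i ≤ p.2 i ^ 2 / (4 * ε) + ε * z i ^ 2 := by
    have : p.2 i ^ 2 / (4 * ε) + ε * z i ^ 2 - p.2 i * z i =
        (p.2 i - 2 * ε * z i) ^ 2 / (4 * ε) := by field_simp; ring
    have h0 : 0 ≤ (p.2 i - 2 * ε * z i) ^ 2 / (4 * ε) := by positivity
    linarith
  have h2 : p.2 i ^ 2 / (4 * ε) ≤ B ^ 2 / (4 * ε) := by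
    refine div_le_div_of_nonneg_right ?_ (by positivity)
    exact sq_le_sq' (abs_le.1 (hB i)).1 (abs_le.1 (hB i)).2
  nlinarith [sq_nonneg (z i)]

lemma continuous_gaussWeight {d : ℕ} (p : ℝ × (Fin d → ℝ)) : Continuous (gaussWeight p) := by
  unfold gaussWeight
  fun_prop

lemma gaussWeight_pos {d : ℕ} (p : ℝ × (Fin d → ℝ)) (z : Fin d → ℝ) : 0 < gaussWeight p z :=
  Real.exp_pos _

lemma GaussIntegrable.aestronglyMeasurable {d : ℕ} {h : (Fin d → ℝ) → ℝ}
    (hh : GaussIntegrable h) : AEStronglyMeasurable h := by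
  have h1 := (hh 1 one_pos).aestronglyMeasurable.mul
    (Continuous.aestronglyMeasurable (μ := volume)
      (f := fun z : Fin d → ℝ => Real.exp (1 * ∑ i, z i ^ 2)) (by fun_prop))
  refine h1.congr (Filter.Eventually.of_forall fun z => ?_)
  simp [mul_assoc, ← Real.exp_add]

lemma GaussIntegrable.integrable_mul_gaussWeight {d : ℕ} {h : (Fin d → ℝ) → ℝ}
    (hh : GaussIntegrable h) {p : ℝ × (Fin d → ℝ)} (hp : 0 < p.1) :
    Integrable fun z => h z * gaussWeight p z := by
  refine ((hh (p.1 / 2) (by positivity)).norm.const_mul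
    (Real.exp (d * (‖p.2‖ ^ 2 / (4 * (p.1 / 2)))))).mono'
    (hh.aestronglyMeasurable.mul (continuous_gaussWeight p).aestronglyMeasurable)
    (Filter.Eventually.of_forall fun z => ?_)
  have := gaussWeight_le (p := p) (ε := p.1 / 2) (B := ‖p.2‖) (by positivity) (by linarith)
    (fun i => norm_le_pi_norm p.2 i) z
  rw [norm_mul, norm_mul, Real.norm_of_nonneg (gaussWeight_pos p z).le, Real.norm_eq_abs (Real.exp _),
    Real.abs_exp]
  calc _ ≤ ‖h z‖ * (Real.exp (d * (‖p.2‖ ^ 2 / (4 * (p.1 / 2)))) *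
          Real.exp (-(p.1 / 2) * ∑ i, z i ^ 2)) := by gcongr
    _ = _ := by ring

/-- The derivative of the exponent of `gaussWeight` in its parameters. -/
noncomputable def gaussExponent {d : ℕ} (z : Fin d → ℝ) : (ℝ × (Fin d → ℝ)) →L[ℝ] ℝ :=
  -((∑ i, z i ^ 2) • ContinuousLinearMap.fst ℝ ℝ (Fin d → ℝ)) +
    ∑ i, z i • (ContinuousLinearMap.proj (R := ℝ) (φ := fun _ : Fin d => ℝ) i ∘L
      ContinuousLinearMap.snd ℝ ℝ (Fin d → ℝ))

lemma gaussWeight_eq {d : ℕ} (p : ℝ × (Fin d → ℝ)) (z : Fin d → ℝ) :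
    gaussWeight p z = Real.exp (gaussExponent z p) := by
  simp [gaussWeight, gaussExponent, mul_comm]

lemma norm_gaussExponent_le {d : ℕ} (z : Fin d → ℝ) :
    ‖gaussExponent z‖ ≤ d + 2 * ∑ i, z i ^ 2 := by
  have hS0 : 0 ≤ ∑ i, z i ^ 2 := Finset.sum_nonneg fun i _ => sq_nonneg _
  refine ContinuousLinearMap.opNorm_le_bound _ (by positivity) fun p => ?_
  have h1 : |p.1| ≤ ‖p‖ := norm_fst_le p
  have h2 : ∀ i, |p.2 i| ≤ ‖p‖ := fun i => (norm_le_pi_norm p.2 i).trans (norm_snd_le p)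
  have e : gaussExponent z p = -((∑ i, z i ^ 2) * p.1) + ∑ i, z i * p.2 i := by
    simp [gaussExponent]
  rw [e]
  calc ‖-((∑ i, z i ^ 2) * p.1) + ∑ i, z i * p.2 i‖
      ≤ (∑ i, z i ^ 2) * |p.1| + ∑ i, |z i| * |p.2 i| := by
        refine (norm_add_le _ _).trans (add_le_add ?_ ?_)
        · rw [norm_neg, norm_mul, Real.norm_of_nonneg hS0, Real.norm_eq_abs]
        · refine (norm_sum_le _ _).trans (le_of_eq ?_)
          simp
    _ ≤ (∑ i, z i ^ 2) * ‖p‖ + ∑ i, (1 + z i ^ 2) * ‖p‖ := by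
        gcongr with i _
        · exact abs_le_one_add_sq _
        · exact h2 i
    _ = _ := by
        rw [← Finset.sum_mul, Finset.sum_add_distrib]
        simp
        ring

lemma hasFDerivAt_gaussTransform {d : ℕ} {h : (Fin d → ℝ) → ℝ} (hh : GaussIntegrable h)
    {p : ℝ × (Fin d → ℝ)} (hp : 0 < p.1) :
    HasFDerivAt (gaussTransform h)
      (-(gaussTransform (fun z => h z * ∑ i, z i ^ 2) p • ContinuousLinearMap.fst ℝ ℝ (Fin d → ℝ)) +
        ∑ i, gaussTransform (fun z => h z * z i) p •
          (ContinuousLinearMap.proj (R := ℝ) (φ := fun _ : Fin d => ℝ) i ∘L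
            ContinuousLinearMap.snd ℝ ℝ (Fin d → ℝ))) p := by
  have hcE : Continuous fun z : Fin d → ℝ => gaussExponent z := by
    unfold gaussExponent
    fun_prop
  have key := hasFDerivAt_integral_of_dominated_of_fderiv_le (𝕜 := ℝ) (μ := volume)
    (F := fun p z => h z * gaussWeight p z)
    (F' := fun p z => (h z * gaussWeight p z) • gaussExponent z) (x₀ := p)
    (s := {q | 2 * (p.1 / 4) ≤ q.1} ∩ {q | ‖q.2‖ ≤ ‖p.2‖ + 1})
    (bound := fun z => ‖(h z * (d + 2 * ∑ i, z i ^ 2)) * Real.exp (-(p.1 / 4) * ∑ i, z i ^ 2)‖ *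
      Real.exp (d * ((‖p.2‖ + 1) ^ 2 / (4 * (p.1 / 4))))) ?_ ?_ ?_ ?_ ?_ ?_ ?_
  · refine HasFDerivAt.congr_fderiv key ?_
    have hfi : ∀ q : (Fin d → ℝ) → ℝ, GaussIntegrable (fun z => h z * q z) →
        ∀ L : (ℝ × (Fin d → ℝ)) →L[ℝ] ℝ,
        Integrable fun z => (h z * q z * gaussWeight p z) • L := fun q hq L =>
      (hq.integrable_mul_gaussWeight hp).smul_const L
    have e : ∀ z, (h z * gaussWeight p z) • gaussExponent z =
        -((h z * (∑ i, z i ^ 2) * gaussWeight p z) • ContinuousLinearMap.fst ℝ ℝ (Fin d → ℝ)) +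
        ∑ i, (h z * z i * gaussWeight p z) •
          (ContinuousLinearMap.proj (R := ℝ) (φ := fun _ : Fin d => ℝ) i ∘L
            ContinuousLinearMap.snd ℝ ℝ (Fin d → ℝ)) := by
      intro z
      rw [gaussExponent, smul_add, Finset.smul_sum, smul_neg, smul_smul]
      congr 2
      · ring_nf
      · ext1 i
        rw [smul_smul]
        ring_nf
    simp_rw [e]
    rw [integral_add, integral_neg, integral_smul_const, integral_finsetSum]
    · simp_rw [integral_smul_const]
      rfl
    · exact fun i _ => hfi _ (hh.mul_coord i) _
    · exact (hfi _ hh.mul_sum_sq _).neg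
    · exact integrable_finsetSum _ fun i _ => hfi _ (hh.mul_coord i) _
  · refine Filter.inter_mem ?_ ?_
    · filter_upwards [(continuous_fst.tendsto p).eventually_const_lt
        (show 2 * (p.1 / 4) < p.1 by linarith)] with q hq using hq.le
    · filter_upwards [(continuous_snd.norm.tendsto p).eventually_lt_const
        (show ‖p.2‖ < ‖p.2‖ + 1 by linarith)] with q hq using hq.le
  · exact Filter.Eventually.of_forall fun q =>
      hh.aestronglyMeasurable.mul (continuous_gaussWeight q).aestronglyMeasurable
  · exact hh.integrable_mul_gaussWeight hp
  · exact (hh.aestronglyMeasurable.mul (continuous_gaussWeight p).aestronglyMeasurable).smul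
      hcE.aestronglyMeasurable
  · refine Filter.Eventually.of_forall fun z q hq => ?_
    have hS0 : 0 ≤ ∑ i, z i ^ 2 := Finset.sum_nonneg fun i _ => sq_nonneg _
    have hw := gaussWeight_le (p := q) (ε := p.1 / 4) (B := ‖p.2‖ + 1) (by positivity) hq.1
      (fun i => (norm_le_pi_norm q.2 i).trans hq.2) z
    rw [norm_smul, norm_mul, norm_mul, norm_mul, Real.norm_of_nonneg (gaussWeight_pos q z).le,
      Real.norm_of_nonneg (Real.exp_pos _).le,
      Real.norm_of_nonneg (show (0 : ℝ) ≤ d + 2 * ∑ i, z i ^ 2 by positivity)]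
    calc _ ≤ ‖h z‖ * (Real.exp (d * ((‖p.2‖ + 1) ^ 2 / (4 * (p.1 / 4)))) *
            Real.exp (-(p.1 / 4) * ∑ i, z i ^ 2)) * (d + 2 * ∑ i, z i ^ 2) := by
          gcongr
          exact norm_gaussExponent_le z
      _ = _ := by ring
  · refine Integrable.mul_const (Integrable.norm ?_) _
    refine hh.mul_of_le (A := d) (B := 2) (by fun_prop) (by positivity) (by norm_num)
      (fun z => ?_) _ (by positivity)
    have hS0 : 0 ≤ ∑ i, z i ^ 2 := Finset.sum_nonneg fun i _ => sq_nonneg _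
    rw [abs_of_nonneg (by positivity)]
  · refine Filter.Eventually.of_forall fun z q _ => ?_
    simp_rw [gaussWeight_eq, mul_smul]
    exact ((gaussExponent z).hasFDerivAt.exp).const_smul (h z)

lemma contDiffOn_gaussTransform {d : ℕ} (n : ℕ) {h : (Fin d → ℝ) → ℝ} (hh : GaussIntegrable h) :
    ContDiffOn ℝ n (gaussTransform h) {p | 0 < p.1} := by
  have hopen : IsOpen {p : ℝ × (Fin d → ℝ) | 0 < p.1} := isOpen_lt continuous_const continuous_fst
  induction n generalizing h with
  | zero =>
    exact contDiffOn_zero.2 fun p hp => (hasFDerivAt_gaussTransform hh hp).continuousAt.continuousWithinAt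
  | succ n ih =>
    push_cast
    rw [contDiffOn_succ_iff_fderiv_of_isOpen hopen]
    refine ⟨fun p hp => (hasFDerivAt_gaussTransform hh hp).differentiableAt.differentiableWithinAt,
      by simp, ?_⟩
    refine ContDiffOn.congr ?_ fun p hp => (hasFDerivAt_gaussTransform hh hp).fderiv
    refine ((ih hh.mul_sum_sq).smul contDiffOn_const).neg.add ?_
    exact ContDiffOn.sum fun i _ => (ih (hh.mul_coord i)).smul contDiffOn_const

lemma gaussTransform_pos {d : ℕ} {f : (Fin d → ℝ) → ℝ} (hf : GaussIntegrable f)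
    (hpos : ∀ z, 0 < f z) {p : ℝ × (Fin d → ℝ)} (hp : 0 < p.1) : 0 < gaussTransform f p := by
  refine (integral_pos_iff_support_of_nonneg (fun z => (mul_pos (hpos z) (gaussWeight_pos p z)).le)
    (hf.integrable_mul_gaussWeight hp)).2 ?_
  have : Function.support (fun z => f z * gaussWeight p z) = Set.univ := by
    ext z; simpa using (mul_pos (hpos z) (gaussWeight_pos p z)).ne'
  rw [this]
  simpa using NeZero.ne (volume : Measure (Fin d → ℝ))

lemma gaussTransform_sum {d : ℕ} {h : Fin d → (Fin d → ℝ) → ℝ} (hh : ∀ i, GaussIntegrable (h i))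
    {p : ℝ × (Fin d → ℝ)} (hp : 0 < p.1) :
    gaussTransform (fun z => ∑ i, h i z) p = ∑ i, gaussTransform (h i) p := by
  simp_rw [gaussTransform, Finset.sum_mul]
  exact integral_finsetSum _ fun i _ => (hh i).integrable_mul_gaussWeight hp

/-- The exponential integral in the time and space variables of the heat equation. -/
noncomputable def heatTransform {d : ℕ} (h : (Fin d → ℝ) → ℝ) (s : ℝ) (x : Fin d → ℝ) : ℝ :=
  gaussTransform h ((2 * s)⁻¹, fun i => x i / s)

lemma hasFDerivAt_heatTransform {d : ℕ} {h : (Fin d → ℝ) → ℝ} (hh : GaussIntegrable h) {s : ℝ}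
    (hs : 0 < s) (x : Fin d → ℝ) :
    HasFDerivAt (heatTransform h s)
      (∑ i, (heatTransform (fun z => h z * z i) s x / s) •
        ContinuousLinearMap.proj (R := ℝ) (φ := fun _ : Fin d => ℝ) i) x := by
  have hp : (0 : ℝ) < (2 * s)⁻¹ := by positivity
  have h1 : HasFDerivAt (fun x : Fin d → ℝ => ((2 * s)⁻¹, fun i => x i / s))
      ((0 : (Fin d → ℝ) →L[ℝ] ℝ).prod (s⁻¹ • ContinuousLinearMap.id ℝ (Fin d → ℝ))) x := by
    refine (hasFDerivAt_const _ _).prodMk ?_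
    have := (hasFDerivAt_id (𝕜 := ℝ) x).const_smul s⁻¹
    refine this.congr_of_eventuallyEq (Filter.Eventually.of_forall fun y => ?_)
    ext i
    simp [div_eq_inv_mul]
  refine ((hasFDerivAt_gaussTransform (p := ((2 * s)⁻¹, fun i => x i / s)) hh hp).comp x
    h1).congr_fderiv ?_
  ext y
  simp only [heatTransform, ContinuousLinearMap.comp_apply, add_apply,
    neg_apply, smul_apply, sum_apply,
    ContinuousLinearMap.prod_apply, zero_apply, ContinuousLinearMap.coe_fst',
    ContinuousLinearMap.coe_snd', ContinuousLinearMap.proj_apply, ContinuousLinearMap.id_apply,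
    Pi.smul_apply, smul_eq_mul, mul_zero, neg_zero, zero_add]
  exact Finset.sum_congr rfl fun i _ => by ring

lemma hasDerivAt_heatTransform {d : ℕ} {h : (Fin d → ℝ) → ℝ} (hh : GaussIntegrable h) {s : ℝ}
    (hs : 0 < s) (x : Fin d → ℝ) :
    HasDerivAt (fun s => heatTransform h s x)
      (∑ i, (heatTransform (fun z => h z * z i * z i) s x / (2 * s ^ 2) -
        heatTransform (fun z => h z * z i) s x * x i / s ^ 2)) s := by
  have hp : (0 : ℝ) < (2 * s)⁻¹ := by positivity
  have h1 : HasDerivAt (fun s : ℝ => ((2 * s)⁻¹, fun i => x i / s))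
      (-(2 * s ^ 2)⁻¹, fun i => -(x i / s ^ 2)) s := by
    refine HasDerivAt.prodMk ?_ (hasDerivAt_pi.2 fun i => ?_)
    · refine (((hasDerivAt_id s).const_mul 2).fun_inv (by simpa using hs.ne')).congr_deriv ?_
      simp only [id]
      field_simp
    · refine ((hasDerivAt_const s (x i)).fun_div (hasDerivAt_id s) hs.ne').congr_deriv ?_
      simp [neg_div]
  refine ((hasFDerivAt_gaussTransform (p := ((2 * s)⁻¹, fun i => x i / s)) hh hp).comp_hasDerivAt s
    h1).congr_deriv ?_
  have e : gaussTransform (fun z => h z * ∑ i, z i ^ 2) ((2 * s)⁻¹, fun i => x i / s) =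
      ∑ i, heatTransform (fun z => h z * z i * z i) s x := by
    simp_rw [heatTransform]
    rw [← gaussTransform_sum (fun i => (hh.mul_coord i).mul_coord i) hp]
    congr 1
    ext z
    rw [Finset.mul_sum]
    exact Finset.sum_congr rfl fun i _ => by ring
  simp only [ContinuousLinearMap.comp_apply, add_apply,
    neg_apply, smul_apply, sum_apply,
    ContinuousLinearMap.coe_fst', ContinuousLinearMap.coe_snd', ContinuousLinearMap.proj_apply,
    smul_eq_mul, e]
  rw [Finset.sum_sub_distrib, ← Finset.sum_div]
  simp only [heatTransform, mul_neg, Finset.sum_neg_distrib, neg_neg, ← sub_eq_add_neg]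
  congr 1
  exact Finset.sum_congr rfl fun i _ => by ring

/-- The logarithm of the solution of the heat equation `∂ₛ u = ½ Δ u` with initial value `f`. -/
noncomputable def logHeat {d : ℕ} (f : (Fin d → ℝ) → ℝ) (s : ℝ) (x : Fin d → ℝ) : ℝ :=
  -(d / 2) * Real.log (2 * Real.pi * s) - (∑ i, x i ^ 2) / (2 * s) +
    Real.log (heatTransform f s x)

/-- The `i`-th partial derivative of `logHeat`. -/
noncomputable def logHeatGrad {d : ℕ} (f : (Fin d → ℝ) → ℝ) (s : ℝ) (i : Fin d)
    (x : Fin d → ℝ) : ℝ :=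
  -(x i / s) + heatTransform (fun z => f z * z i) s x / heatTransform f s x / s

section LogHeat

variable {d : ℕ} {f : (Fin d → ℝ) → ℝ} {s : ℝ}

lemma heatTransform_pos (hf : GaussIntegrable f) (hpos : ∀ z, 0 < f z) (hs : 0 < s)
    (x : Fin d → ℝ) : 0 < heatTransform f s x :=
  gaussTransform_pos hf hpos (p := ((2 * s)⁻¹, fun i => x i / s)) (by positivity)

lemma log_integral_stdGaussian (hf : GaussIntegrable f) (hpos : ∀ z, 0 < f z) (hs : 0 < s)
    (x : Fin d → ℝ) :
    Real.log (∫ y, f (x + Real.sqrt s • y) ∂(stdGaussian d)) = logHeat f s x := by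
  have h0 : 0 < 2 * Real.pi * s := by positivity
  have h1 : 0 < Real.sqrt (2 * Real.pi * s) := Real.sqrt_pos.2 h0
  have h2 : gaussTransform f ((2 * s)⁻¹, fun i => x i / s) ≠ 0 :=
    (heatTransform_pos hf hpos hs x).ne'
  rw [integral_stdGaussian_comp_add_smul f x hs, Real.log_mul (by positivity) h2,
    Real.log_mul (by positivity) (by positivity), Real.log_exp, Real.log_pow, Real.log_inv,
    Real.log_sqrt h0.le, logHeat, heatTransform]
  ring

lemma hasFDerivAt_logHeat (hf : GaussIntegrable f) (hpos : ∀ z, 0 < f z) (hs : 0 < s)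
    (x : Fin d → ℝ) :
    HasFDerivAt (logHeat f s)
      (∑ i, logHeatGrad f s i x • ContinuousLinearMap.proj (R := ℝ) (φ := fun _ : Fin d => ℝ) i)
      x := by
  have hF := (heatTransform_pos hf hpos hs x).ne'
  have h1 : HasFDerivAt (fun x : Fin d → ℝ => (∑ i, x i ^ 2) / (2 * s))
      (∑ i, (x i / s) • ContinuousLinearMap.proj (R := ℝ) (φ := fun _ : Fin d => ℝ) i) x := by
    have := (HasFDerivAt.fun_sum (u := Finset.univ) (x := x) fun i _ =>
      (hasFDerivAt_apply (𝕜 := ℝ) (F' := fun _ : Fin d => ℝ) i x).pow 2).mul_const (2 * s)⁻¹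
    refine this.congr_fderiv ?_
    ext y
    simp only [smul_apply, sum_apply,
      ContinuousLinearMap.proj_apply, smul_eq_mul, Finset.mul_sum]
    refine Finset.sum_congr rfl fun i _ => ?_
    field_simp
    simp [mul_right_comm]
  refine ((h1.const_sub (-(d / 2 : ℝ) * Real.log (2 * Real.pi * s))).add
    ((hasFDerivAt_heatTransform hf hs x).log hF)).congr_fderiv ?_
  ext y
  simp only [smul_apply, sum_apply,
    add_apply, neg_apply,
    ContinuousLinearMap.proj_apply, smul_eq_mul, Finset.mul_sum, logHeatGrad,
    ← Finset.sum_neg_distrib, ← Finset.sum_add_distrib]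
  exact Finset.sum_congr rfl fun i _ => by ring

lemma fderiv_logHeat_single (hf : GaussIntegrable f) (hpos : ∀ z, 0 < f z) (hs : 0 < s)
    (x : Fin d → ℝ) (i : Fin d) :
    fderiv ℝ (logHeat f s) x (Pi.single i 1) = logHeatGrad f s i x := by
  rw [(hasFDerivAt_logHeat hf hpos hs x).fderiv]
  simp [Pi.single_apply]

lemma differentiableAt_logHeatGrad (hf : GaussIntegrable f) (hpos : ∀ z, 0 < f z) (hs : 0 < s)
    (x : Fin d → ℝ) (i : Fin d) : DifferentiableAt ℝ (logHeatGrad f s i) x := by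
  have h1 : DifferentiableAt ℝ (fun x : Fin d → ℝ => -(x i / s)) x := by fun_prop
  exact h1.add (((hasFDerivAt_heatTransform (hf.mul_coord i) hs x).differentiableAt.mul
    ((hasFDerivAt_heatTransform hf hs x).differentiableAt.inv
      (heatTransform_pos hf hpos hs x).ne')).mul_const s⁻¹)

lemma fderiv_logHeatGrad_single (hf : GaussIntegrable f) (hpos : ∀ z, 0 < f z) (hs : 0 < s)
    (x : Fin d → ℝ) (i : Fin d) :
    fderiv ℝ (logHeatGrad f s i) x (Pi.single i 1) =
      -s⁻¹ + (heatTransform (fun z => f z * z i * z i) s x / heatTransform f s x -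
        (heatTransform (fun z => f z * z i) s x / heatTransform f s x) ^ 2) / s ^ 2 := by
  have hF := (heatTransform_pos hf hpos hs x).ne'
  have h1 := (hasFDerivAt_apply (𝕜 := ℝ) (F' := fun _ : Fin d => ℝ) i x).mul_const s⁻¹
  have h2 := hasFDerivAt_heatTransform (hf.mul_coord i) hs x
  have h3 := (hasFDerivAt_heatTransform hf hs x)
  have h4 := (h1.neg.add ((h2.mul ((hasDerivAt_inv hF).comp_hasFDerivAt x h3)).mul_const s⁻¹))
  have h5 : HasFDerivAt (logHeatGrad f s i) _ x := h4
  rw [h5.fderiv]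
  simp [Pi.single_apply]
  field_simp
  ring

lemma hasDerivAt_logHeat (hf : GaussIntegrable f) (hpos : ∀ z, 0 < f z) (hs : 0 < s)
    (x : Fin d → ℝ) :
    HasDerivAt (fun s => logHeat f s x)
      (2⁻¹ * ∑ i, (fderiv ℝ (logHeatGrad f s i) x (Pi.single i 1) + logHeatGrad f s i x ^ 2))
      s := by
  have hF := (heatTransform_pos hf hpos hs x).ne'
  have h0 : 2 * Real.pi * s ≠ 0 := by positivity
  have h1 := (((hasDerivAt_id s).const_mul (2 * Real.pi)).log h0).const_mul (-((d : ℝ) / 2))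
  have h2 := (hasDerivAt_const s (∑ i, x i ^ 2)).fun_div ((hasDerivAt_id s).const_mul 2)
    (by simpa using hs.ne')
  refine ((h1.sub h2).add ((hasDerivAt_heatTransform hf hs x).log hF)).congr_deriv ?_
  have e1 : -((d : ℝ) / 2) * (2 * Real.pi * 1 / (2 * Real.pi * id s)) =
      ∑ _i : Fin d, -(2 * s)⁻¹ := by
    simp only [Finset.sum_const, Finset.card_univ, Fintype.card_fin, nsmul_eq_mul, id]
    field_simp
  have e2 : (0 * (2 * id s) - (∑ i, x i ^ 2) * (2 * 1)) / (2 * id s) ^ 2 =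
      ∑ i, -(x i ^ 2 / (2 * s ^ 2)) := by
    rw [Finset.sum_neg_distrib, ← Finset.sum_div]
    simp only [id]
    field_simp
    ring
  rw [e1, e2, Finset.sum_div, ← Finset.sum_sub_distrib, ← Finset.sum_add_distrib, Finset.mul_sum]
  refine Finset.sum_congr rfl fun i _ => ?_
  rw [fderiv_logHeatGrad_single hf hpos hs, logHeatGrad]
  field_simp
  ring

lemma contDiff_logHeat (hf : GaussIntegrable f) (hpos : ∀ z, 0 < f z) (hs : 0 < s) (n : ℕ) :
    ContDiff ℝ n (logHeat f s) := by
  have hF : ContDiff ℝ n (heatTransform f s) := by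
    have h1 : ContDiff ℝ n fun x : Fin d → ℝ => ((2 * s)⁻¹, fun i => x i / s) := by fun_prop
    exact (contDiffOn_gaussTransform n hf).comp_contDiff h1 fun x => by
      simpa using hs
  have h2 := hF.log fun x => (heatTransform_pos hf hpos hs x).ne'
  exact ContDiff.add (by fun_prop) h2

end LogHeat

theorem cole_hopf_reference_solution_advection_diffusion
    (d : ℕ) (T α β : ℝ) (hT : 0 < T) (hα : 0 < α) (hβ : 0 < β)
    (g : (Fin d → ℝ) → ℝ) (hgc : Continuous g) (hgb : ∃ C, ∀ x, |g x| ≤ C)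
    (v : ℝ → (Fin d → ℝ) → ℝ)
    (hv : v = fun t x => α / (2 * β) *
      Real.log (∫ y, Real.exp (2 * β / α * g (x + Real.sqrt (2 * α * (T - t)) • y))
        ∂(stdGaussian d))) :
    ContinuousOn (fun p : ℝ × (Fin d → ℝ) => v p.1 p.2) (Set.Icc 0 T ×ˢ Set.univ) ∧
    (∀ t ∈ Set.Ico (0 : ℝ) T, ∀ x : Fin d → ℝ, DifferentiableAt ℝ (fun s => v s x) t) ∧
    (∀ t ∈ Set.Ico (0 : ℝ) T, ContDiff ℝ 2 fun x => v t x) ∧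
    (∀ t ∈ Set.Ico (0 : ℝ) T, ∀ x : Fin d → ℝ,
      deriv (fun s => v s x) t + α * lap' d (v t) x
          + 2 * β * ∑ i : Fin d, (pderiv' d (v t) x i) ^ 2 = 0) ∧
    (∀ x : Fin d → ℝ, v T x = g x) := by
  obtain ⟨C, hC⟩ := hgb
  set f : (Fin d → ℝ) → ℝ := fun z => Real.exp (2 * β / α * g z) with hfdef
  have hfc : Continuous f := by fun_prop
  have hpos : ∀ z, 0 < f z := fun z => Real.exp_pos _
  have hfC : ∀ z, |f z| ≤ Real.exp (2 * β / α * C) := fun z => by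
    rw [hfdef, Real.abs_exp]
    have := (abs_le.1 (hC z)).2
    gcongr
  have hf : GaussIntegrable f := .of_bounded hfc hfC
  have : IsProbabilityMeasure (_root_.stdGaussian d) := by
    unfold _root_.stdGaussian
    infer_instance
  have hvt : ∀ t < T, v t = fun x => α / (2 * β) * logHeat f (2 * α * (T - t)) x := by
    intro t ht
    have hs : 0 < 2 * α * (T - t) := mul_pos (by positivity) (by linarith)
    rw [hv]
    ext x
    rw [← log_integral_stdGaussian hf hpos hs]
  have hder : ∀ t < T, ∀ x, HasDerivAt (fun s => v s x) (α / (2 * β) *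
      ((2⁻¹ * ∑ i, (fderiv ℝ (logHeatGrad f (2 * α * (T - t)) i) x (Pi.single i 1) +
        logHeatGrad f (2 * α * (T - t)) i x ^ 2)) * (2 * α * (-1)))) t := by
    intro t ht x
    have hs : 0 < 2 * α * (T - t) := mul_pos (by positivity) (by linarith)
    have h1 := (((hasDerivAt_id t).const_sub T).const_mul (2 * α))
    have h2 := ((hasDerivAt_logHeat hf hpos hs x).comp t h1).const_mul (α / (2 * β))
    refine h2.congr_of_eventuallyEq ?_
    filter_upwards [eventually_lt_nhds ht] with r hr
    rw [hvt r hr]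
    rfl
  refine ⟨Continuous.continuousOn ?_, fun t ht x => (hder t ht.2 x).differentiableAt, fun t ht => ?_,
    fun t ht x => ?_, fun x => ?_⟩
  · have hb : ∀ (p : ℝ × (Fin d → ℝ)), Continuous fun y =>
        f (p.2 + Real.sqrt (2 * α * (T - p.1)) • y) := fun p => by fun_prop
    have hcont : Continuous fun p : ℝ × (Fin d → ℝ) =>
        ∫ y, f (p.2 + Real.sqrt (2 * α * (T - p.1)) • y) ∂(stdGaussian d) := by
      refine continuous_of_dominated (bound := fun _ => Real.exp (2 * β / α * C))
        (fun p => (hb p).aestronglyMeasurable) (fun p => .of_forall fun y => hfC _)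
        (integrable_const _) (.of_forall fun y => by fun_prop)
    rw [hv]
    refine continuous_const.mul (hcont.log fun p => ne_of_gt ?_)
    refine integral_exp_pos (.of_bound (hb p).aestronglyMeasurable _
      (.of_forall fun y => hfC _))
  · have hs : 0 < 2 * α * (T - t) := mul_pos (by positivity) (by linarith [ht.2])
    rw [hvt t ht.2]
    exact contDiff_const.mul (contDiff_logHeat hf hpos hs 2)
  · have hs : 0 < 2 * α * (T - t) := mul_pos (by positivity) (by linarith [ht.2])
    have hgrad : ∀ y i, fderiv ℝ (v t) y (Pi.single i 1) =
        α / (2 * β) * logHeatGrad f (2 * α * (T - t)) i y := fun y i => by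
      rw [hvt t ht.2, fderiv_const_mul (hasFDerivAt_logHeat hf hpos hs y).differentiableAt,
        smul_apply, fderiv_logHeat_single hf hpos hs, smul_eq_mul]
    have hlap : ∀ i, fderiv ℝ (fun y => fderiv ℝ (v t) y (Pi.single i 1)) x (Pi.single i 1) =
        α / (2 * β) * fderiv ℝ (logHeatGrad f (2 * α * (T - t)) i) x (Pi.single i 1) := fun i => by
      simp_rw [hgrad]
      rw [fderiv_const_mul (differentiableAt_logHeatGrad hf hpos hs x i), smul_apply, smul_eq_mul]
    rw [(hder t ht.2 x).deriv, lap']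
    simp_rw [pderiv', hlap, hgrad, Finset.sum_add_distrib, mul_pow, ← Finset.mul_sum]
    field_simp
    ring
  · rw [hv]
    simp only [sub_self, mul_zero, Real.sqrt_zero, zero_smul, add_zero, integral_const,
      probReal_univ, one_smul, Real.log_exp]
    field_simp
end
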